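/- arXiv:1411.1620 — 2 statements merged into one kernel-verified Lean document; each statement's English description precedes it below -/
import Mathlib

section
/- Let 0 < ε < 1/2 and let f : 𝕋^∞ → ℝ be a measurable function that is 1-Lipschitz with respect to the supremum metric dist_∞. Then there exists a parallel infinite-dimensional subtorus M ⊆ 𝕋^∞ such that the restriction f|_M is measurable and essosc(f; M) ≤ 8ε, where the essential oscillation is taken with respect to the uniform probability measure on M. -/
noncomputable section
open MeasureTheory ENNReal Filter
open scoped Classical

/-- The infinite-dimensional torus `𝕋^∞ = (ℝ/ℤ)^ℕ`. -/
abbrev InfTorus : Type := ℕ → AddCircle (1 : ℝ)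

/-- The product of the uniform probability measures on the circles `ℝ/ℤ`, realized as the
normalized Haar measure on the compact group `𝕋^∞` (by uniqueness of the translation-invariant
Borel probability measure, they coincide). -/
def torusMeasure : Measure InfTorus :=
  Measure.addHaarMeasure (⊤ : TopologicalSpace.PositiveCompacts InfTorus)

/-- The map fixing all coordinates outside `A` to the values of `b`. -/
def subtorusProj (A : Set ℕ) (b : InfTorus) (x : InfTorus) : InfTorus :=
  fun i => if i ∈ A then x i else b i

/-- The uniform probability measure on the parallel subtorus
`M = {x | ∀ i ∉ A, x i = b i}`: the pushforward of the product measure under the projection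
onto `M`, i.e. the product of uniform measures over the coordinates in `A`, the remaining
coordinates being fixed to the values of `b`. -/
def subtorusMeasure (A : Set ℕ) (b : InfTorus) : Measure InfTorus :=
  torusMeasure.map (subtorusProj A b)

/-- The essential oscillation `essosc(f;μ) = ess sup f - ess inf f`, expressed equivalently
as the `L^∞(μ × μ)`-norm of `(x,y) ↦ f x - f y`, valued in `[0,∞]`. -/
def essOsc (μ : Measure InfTorus) (f : InfTorus → ℝ) : ℝ≥0∞ :=
  essSup (fun z : InfTorus × InfTorus => ENNReal.ofReal |f z.1 - f z.2|) (μ.prod μ)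

/-- The supremum metric `dist_∞(x,y) = supᵢ dist(xᵢ,yᵢ)` on the infinite torus
(always finite, since `dist ≤ 1/2` on `ℝ/ℤ`). -/
def distInfty (x y : InfTorus) : ℝ := ⨆ i, dist (x i) (y i)

instance : IsProbabilityMeasure torusMeasure :=
  ⟨by simpa [torusMeasure] using
    Measure.addHaarMeasure_self (K₀ := (⊤ : TopologicalSpace.PositiveCompacts InfTorus))⟩

instance : torusMeasure.IsAddHaarMeasure := by
  unfold torusMeasure; infer_instance

instance : torusMeasure.Regular := by
  unfold torusMeasure; infer_instance

/-- Translation of an integrable function is continuous in mean at the origin. -/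
theorem tendsto_lintegral_translate_sub {f : InfTorus → ℝ} (hf : Integrable f torusMeasure) :
    Tendsto (fun h : InfTorus => ∫⁻ b, ‖f (h + b) - f b‖ₑ ∂torusMeasure) (nhds 0) (nhds 0) := by
  have hL : MemLp f 1 torusMeasure := memLp_one_iff_integrable.2 hf
  have hne : Fact ((1 : ℝ≥0∞) ≠ ∞) := ⟨one_ne_top⟩
  have hact : ContinuousVAdd InfTorusᵈᵃᵃ (Lp ℝ 1 torusMeasure) :=
    Lp.instContinuousVAddDomAddAct
  have hcont : Continuous fun h : InfTorus =>
      edist (DomAddAct.mk h +ᵥ hL.toLp f) (hL.toLp f) :=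
    ((DomAddAct.continuous_mk.vadd continuous_const).edist continuous_const)
  have h0 := hcont.tendsto 0
  have heq (h : InfTorus) : edist (DomAddAct.mk h +ᵥ hL.toLp f) (hL.toLp f) =
      ∫⁻ b, ‖f (h + b) - f b‖ₑ ∂torusMeasure := by
    rw [DomAddAct.mk_vadd_toLp, Lp.edist_toLp_toLp, eLpNorm_one_eq_lintegral_enorm]
    rfl
  simp only [heq] at h0
  simpa using h0

/-- Translations supported on far away coordinates have a small effect in mean. -/
theorem eventually_lintegral_translate_sub_le {f : InfTorus → ℝ} (hf : Integrable f torusMeasure)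
    {δ : ℝ≥0∞} (hδ : 0 < δ) :
    ∀ᶠ n in atTop, ∀ h : InfTorus, (∀ i < n, h i = 0) →
      ∫⁻ b, ‖f (h + b) - f b‖ₑ ∂torusMeasure ≤ δ := by
  have h1 := (tendsto_lintegral_translate_sub hf).eventually (ge_mem_nhds hδ)
  rw [nhds_pi, Filter.eventually_iff, Filter.mem_pi] at h1
  obtain ⟨I, hI, t, ht, hsub⟩ := h1
  obtain ⟨N, hN⟩ := hI.bddAbove
  filter_upwards [eventually_gt_atTop N] with n hn h hh
  refine hsub fun i hi => ?_
  rw [hh i ((hN hi).trans_lt hn)]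
  exact mem_of_mem_nhds (ht i)

theorem lintegral_translate_add_sub {f : InfTorus → ℝ} (v h : InfTorus) :
    ∫⁻ b, ‖f (h + v + b) - f (v + b)‖ₑ ∂torusMeasure =
      ∫⁻ b, ‖f (h + b) - f b‖ₑ ∂torusMeasure := by
  simpa only [add_assoc] using
    lintegral_add_left_eq_self (μ := torusMeasure) (fun b => ‖f (h + b) - f b‖ₑ) v

/-- The points whose coordinates `a 0, …, a (k - 1)` lie in `S` (when `a` is injective), all other
coordinates being zero. -/
def gridPoints (a : ℕ → ℕ) (S : Finset (AddCircle (1 : ℝ))) : ℕ → Finset InfTorus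
  | 0 => {0}
  | k + 1 => Finset.image₂ (fun t v => Pi.single (a k) t + v) S (gridPoints a S k)

theorem card_gridPoints_le (a : ℕ → ℕ) (S : Finset (AddCircle (1 : ℝ))) (k : ℕ) :
    (gridPoints a S k).card ≤ S.card ^ k := by
  induction k with
  | zero => simp [gridPoints]
  | succ k ih =>
    rw [pow_succ']
    exact (Finset.card_image₂_le _ _ _).trans (Nat.mul_le_mul_left _ ih)

/-- The point with the same coordinates as `c` at `a 0, …, a (k - 1)`, and zero elsewhere. -/
def truncation (a : ℕ → ℕ) (c : InfTorus) : ℕ → InfTorus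
  | 0 => 0
  | k + 1 => Pi.single (a k) (c (a k)) + truncation a c k

theorem truncation_mem_gridPoints (a : ℕ → ℕ) {S : Finset (AddCircle (1 : ℝ))} {c : InfTorus}
    (hc : ∀ i, c i ∈ S) (k : ℕ) : truncation a c k ∈ gridPoints a S k := by
  induction k with
  | zero => simp [gridPoints, truncation]
  | succ k ih => exact Finset.mem_image₂_of_mem (hc _) ih

theorem truncation_apply {a : ℕ → ℕ} (ha : StrictMono a) (c : InfTorus) (k i : ℕ) :
    truncation a c k i = if i ∈ a '' Set.Iio k then c i else 0 := by
  induction k with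
  | zero => simp [truncation]
  | succ k ih =>
    rw [truncation, Pi.add_apply, ih, Pi.single_apply]
    by_cases hi : i = a k
    · subst hi
      have h1 : a k ∉ a '' Set.Iio k := by
        rintro ⟨j, hj, hjk⟩
        exact hj.ne (ha.injective hjk)
      have h2 : a k ∈ a '' Set.Iio (k + 1) := ⟨k, Nat.lt_succ_self k, rfl⟩
      simp only [if_pos h2, if_neg h1, if_true, add_zero]
    · have : i ∈ a '' Set.Iio (k + 1) ↔ i ∈ a '' Set.Iio k := by
        constructor
        · rintro ⟨j, hj, rfl⟩
          refine ⟨j, lt_of_le_of_ne (Nat.lt_succ_iff.1 hj) ?_, rfl⟩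
          rintro rfl
          exact hi rfl
        · rintro ⟨j, hj, rfl⟩
          exact ⟨j, Nat.lt_succ_of_lt hj, rfl⟩
      simp only [this, if_neg hi, zero_add]

theorem subtorusProj_sub_truncation_apply {a : ℕ → ℕ} (ha : StrictMono a) (c : InfTorus)
    {k i : ℕ} (hi : i < a k) :
    (subtorusProj (Set.range a) 0 c - truncation a c k) i = 0 := by
  have : i ∈ a '' Set.Iio k ↔ i ∈ Set.range a := by
    constructor
    · rintro ⟨j, -, rfl⟩
      exact ⟨j, rfl⟩
    · rintro ⟨j, rfl⟩
      exact ⟨j, ha.lt_iff_lt.1 hi, rfl⟩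
  rw [Pi.sub_apply, truncation_apply ha, subtorusProj, this]
  simp

/-- The total variation of `f` along all edges of the tree of grid points, based at `b`. -/
def gridVariation (f : InfTorus → ℝ) (a : ℕ → ℕ) (S : Finset (AddCircle (1 : ℝ)))
    (b : InfTorus) : ℝ≥0∞ :=
  ∑' k, ∑ v ∈ gridPoints a S k, ∑ t ∈ S, ‖f (Pi.single (a k) t + v + b) - f (v + b)‖ₑ

theorem measurable_gridVariation {f : InfTorus → ℝ} (hf : Measurable f) (a : ℕ → ℕ)
    (S : Finset (AddCircle (1 : ℝ))) : Measurable (gridVariation f a S) := by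
  unfold gridVariation
  fun_prop

theorem enorm_truncation_sub_le_gridVariation (f : InfTorus → ℝ) (a : ℕ → ℕ)
    {S : Finset (AddCircle (1 : ℝ))} {c : InfTorus} (hc : ∀ i, c i ∈ S) (k : ℕ) (b : InfTorus) :
    ‖f (truncation a c k + b) - f b‖ₑ ≤ gridVariation f a S b := by
  refine le_trans ?_ (ENNReal.sum_le_tsum (Finset.range k))
  induction k with
  | zero => simp [truncation]
  | succ k ih =>
    rw [Finset.sum_range_succ, ← sub_add_sub_cancel _ (f (truncation a c k + b)), add_comm]
    refine (enorm_add_le _ _).trans (add_le_add ih ?_)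
    refine le_trans ?_ (Finset.single_le_sum (fun _ _ => zero_le)
      (truncation_mem_gridPoints a hc k))
    exact Finset.single_le_sum (f := fun t => ‖f (Pi.single (a k) t + truncation a c k + b) -
      f (truncation a c k + b)‖ₑ) (fun _ _ => zero_le) (hc (a k))

theorem lintegral_gridVariation_le {f : InfTorus → ℝ} (hf : Measurable f) (a : ℕ → ℕ)
    (S : Finset (AddCircle (1 : ℝ))) (δ : ℕ → ℝ≥0∞)
    (h : ∀ k t, ∫⁻ b, ‖f (Pi.single (a k) t + b) - f b‖ₑ ∂torusMeasure ≤ δ k) :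
    ∫⁻ b, gridVariation f a S b ∂torusMeasure ≤ ∑' k, (S.card : ℝ≥0∞) ^ (k + 1) * δ k := by
  unfold gridVariation
  rw [lintegral_tsum fun k => by fun_prop]
  refine ENNReal.tsum_le_tsum fun k => ?_
  rw [lintegral_finsetSum _ fun v _ => by fun_prop]
  calc
    _ ≤ ∑ v ∈ gridPoints a S k, ∑ t ∈ S, δ k := by
      refine Finset.sum_le_sum fun v _ => ?_
      rw [lintegral_finsetSum _ fun t _ => by fun_prop]
      refine Finset.sum_le_sum fun t _ => ?_
      rw [lintegral_translate_add_sub]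
      exact h k t
    _ ≤ _ := by
      simp only [Finset.sum_const, nsmul_eq_mul]
      rw [pow_succ, mul_assoc]
      gcongr
      exact_mod_cast card_gridPoints_le a S k

/-- For any finite set `S` there is a sparse set of coordinates such that, for most points `b`,
translating `b` in these coordinates by elements of `S` does not change `f` much. -/
theorem exists_strictMono_enorm_translate_sub_le {f : InfTorus → ℝ} (hf : Measurable f)
    (hint : Integrable f torusMeasure) (S : Finset (AddCircle (1 : ℝ))) {ε : ℝ≥0∞} (hε : ε ≠ 0) :
    ∃ (a : ℕ → ℕ) (D : InfTorus → ℝ≥0∞), StrictMono a ∧ Measurable D ∧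
      ∫⁻ b, D b ∂torusMeasure ≤ ε ∧
      ∀ c : InfTorus, (∀ i, c i ∈ S) → ∀ᵐ b ∂torusMeasure,
        ‖f (subtorusProj (Set.range a) 0 c + b) - f b‖ₑ ≤ D b := by
  obtain ⟨ε', hpos, hsum⟩ := ENNReal.exists_pos_sum_of_countable' hε ℕ
  set C : ℝ≥0∞ := S.card + 1 with hC
  have hCtop : C ≠ ∞ := by simp [hC]
  have hC1 : 1 ≤ C := by simp [hC]
  have hC0 : C ≠ 0 := (zero_lt_one.trans_le hC1).ne'
  set δ : ℕ → ℝ≥0∞ := fun k => ε' k / C ^ (k + 1) with hδ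
  have hδpos (k : ℕ) : 0 < δ k := ENNReal.div_pos (hpos k).ne' (ENNReal.pow_ne_top hCtop)
  obtain ⟨a, ha, hau⟩ := extraction_forall_of_eventually fun k =>
    eventually_lintegral_translate_sub_le hint (hδpos k)
  refine ⟨a, gridVariation f a S, ha, measurable_gridVariation hf a S, ?_, ?_⟩
  · refine (lintegral_gridVariation_le hf a S δ fun k t => hau k _ fun i hi => ?_).trans ?_
    · simp [hi.ne]
    · refine le_trans (ENNReal.tsum_le_tsum fun k => ?_) hsum.le
      calc (S.card : ℝ≥0∞) ^ (k + 1) * δ k ≤ C ^ (k + 1) * δ k := by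
            gcongr
            exact le_self_add
        _ ≤ ε' k := ENNReal.mul_div_le
  · intro c hc
    set w := subtorusProj (Set.range a) 0 c with hw
    set X : InfTorus → ℝ≥0∞ := fun b => ‖f (w + b) - f b‖ₑ with hX
    have hbound (k : ℕ) :
        ∫⁻ b, (X b - gridVariation f a S b) ∂torusMeasure ≤ ε' k := by
      calc
        _ ≤ ∫⁻ b, ‖f (w - truncation a c k + truncation a c k + b) -
              f (truncation a c k + b)‖ₑ ∂torusMeasure := by
          refine lintegral_mono fun b => tsub_le_iff_right.2 ?_
          rw [sub_add_cancel]
          calc X b = ‖(f (w + b) - f (truncation a c k + b)) +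
                (f (truncation a c k + b) - f b)‖ₑ := by rw [sub_add_sub_cancel]
            _ ≤ _ := (enorm_add_le _ _).trans
              (add_le_add le_rfl (enorm_truncation_sub_le_gridVariation f a hc k b))
        _ ≤ δ k := by
          rw [lintegral_translate_add_sub]
          exact hau k _ fun i hi => subtorusProj_sub_truncation_apply ha c hi
        _ ≤ ε' k := ENNReal.div_le_of_le_mul
          (le_mul_of_one_le_right zero_le (one_le_pow₀ hC1))
    have hlim : Tendsto ε' atTop (nhds 0) :=
      ENNReal.tendsto_atTop_zero_of_tsum_ne_top (hsum.trans_le le_top).ne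
    have hzero : ∫⁻ b, (X b - gridVariation f a S b) ∂torusMeasure = 0 :=
      le_antisymm (ge_of_tendsto' hlim hbound) zero_le
    have hmeas : Measurable fun b => X b - gridVariation f a S b := by
      have := measurable_gridVariation hf a S
      fun_prop
    filter_upwards [(lintegral_eq_zero_iff hmeas).1 hzero] with b hb
    exact tsub_eq_zero_iff_le.1 hb

theorem ae_add_left {q : InfTorus → Prop} (v : InfTorus) (h : ∀ᵐ y ∂torusMeasure, q y) :
    ∀ᵐ y ∂torusMeasure, q (v + y) := by
  have h2 : MeasurePreserving (fun y : InfTorus => v + y) torusMeasure torusMeasure :=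
    measurePreserving_add_left torusMeasure v
  exact h2.quasiMeasurePreserving.ae h

theorem ae_sub_right {q : InfTorus → Prop} (b : InfTorus) (h : ∀ᵐ y ∂torusMeasure, q y) :
    ∀ᵐ y ∂torusMeasure, q (y - b) := by
  have h2 : MeasurePreserving (fun y : InfTorus => y - b) torusMeasure torusMeasure :=
    measurePreserving_sub_right torusMeasure b
  exact h2.quasiMeasurePreserving.ae h

theorem ae_ae_sub_of_forall_ae {q : InfTorus → InfTorus → Prop}
    (hq : MeasurableSet {p : InfTorus × InfTorus | q p.1 p.2})
    (h : ∀ z, ∀ᵐ b ∂torusMeasure, q z b) :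
    ∀ᵐ b ∂torusMeasure, ∀ᵐ y ∂torusMeasure, q (y - b) b := by
  exact ((Measure.ae_ae_comm hq).1 (ae_of_all _ h)).mono fun b hb => ae_sub_right (q := (q · b)) b hb

theorem measurable_subtorusProj (A : Set ℕ) (b : InfTorus) : Measurable (subtorusProj A b) := by
  refine measurable_pi_lambda _ fun i => ?_
  by_cases hi : i ∈ A <;> simp only [subtorusProj, hi, if_true, if_false] <;> fun_prop

theorem subtorusProj_zero_sub_add (A : Set ℕ) (b y : InfTorus) :
    subtorusProj A 0 (y - b) + b = subtorusProj A b y := by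
  funext i
  by_cases hi : i ∈ A <;> simp [subtorusProj, hi]

theorem essOsc_le_of_ae_enorm_sub_le {μ : Measure InfTorus} [SFinite μ] {f : InfTorus → ℝ}
    {r : ℝ≥0∞} (m : ℝ) (h : ∀ᵐ x ∂μ, ‖f x - m‖ₑ ≤ r) : essOsc μ f ≤ r + r := by
  refine essSup_le_of_ae_le _ ?_
  filter_upwards [Measure.quasiMeasurePreserving_fst.ae h,
    Measure.quasiMeasurePreserving_snd.ae h] with z h1 h2
  rw [← Real.enorm_eq_ofReal_abs, ← sub_sub_sub_cancel_right (f z.1) (f z.2) m]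
  exact (enorm_sub_le).trans (add_le_add h1 h2)

theorem dist_le_half (x y : AddCircle (1 : ℝ)) : dist x y ≤ 1 / 2 := by
  rw [dist_eq_norm]
  simpa using AddCircle.norm_le_half_period (1 : ℝ) one_ne_zero (x := x - y)

theorem integrable_of_abs_sub_le_distInfty {f : InfTorus → ℝ}
    (hmeas : AEMeasurable f torusMeasure)
    (hlip : ∀ x y : InfTorus, |f x - f y| ≤ distInfty x y) : Integrable f torusMeasure := by
  refine Integrable.of_bound hmeas.aestronglyMeasurable (1 / 2 + |f 0|)
    (Eventually.of_forall fun x => ?_)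
  have h1 : distInfty x 0 ≤ 1 / 2 := ciSup_le fun i => dist_le_half _ _
  have h2 := abs_sub_abs_le_abs_sub (f x) (f 0)
  rw [Real.norm_eq_abs]
  linarith [hlip x 0]

/-- A measurable map of the circle with finite range which is uniformly close to the identity. -/
theorem exists_simpleFunc_dist_le {ε : ℝ} (hε : 0 < ε) :
    ∃ g : SimpleFunc (AddCircle (1 : ℝ)) (AddCircle (1 : ℝ)), ∀ x, dist x (g x) ≤ ε := by
  let e := TopologicalSpace.denseSeq (AddCircle (1 : ℝ))
  have hcover : (Set.univ : Set (AddCircle (1 : ℝ))) ⊆ ⋃ n, Metric.ball (e n) ε := by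
    intro x _
    obtain ⟨_, ⟨n, rfl⟩, hn⟩ := Metric.dense_iff.1
      (TopologicalSpace.denseRange_denseSeq (AddCircle (1 : ℝ))) x ε hε |>.imp fun _ h => h.symm
    exact Set.mem_iUnion.2 ⟨n, Metric.mem_ball_comm.1 hn⟩
  obtain ⟨t, ht⟩ := isCompact_univ.elim_finite_subcover _ (fun n => Metric.isOpen_ball) hcover
  refine ⟨SimpleFunc.nearestPt e (t.sup id), fun x => ?_⟩
  obtain ⟨n, hn, hx⟩ := Set.mem_iUnion₂.1 (ht (Set.mem_univ x))
  have h1 := SimpleFunc.edist_nearestPt_le e x (Finset.le_sup (f := id) hn)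
  rw [edist_dist, edist_dist, ENNReal.ofReal_le_ofReal_iff dist_nonneg] at h1
  rw [dist_comm]
  exact h1.trans (Metric.mem_ball'.1 hx).le

/-- Let `0 < ε < 1/2` and let `f : 𝕋^∞ → ℝ` be measurable and `1`-Lipschitz
w.r.t. the supremum metric `dist_∞`. Then there is a parallel infinite-dimensional subtorus
(given by an infinite coordinate set `A` and fixed values `b`) on which `f` is measurable and
has essential oscillation at most `8ε`. -/
theorem exists_subtorus_essOsc_le_dist_infty (ε : ℝ) (hε0 : 0 < ε) (hε : ε < 1 / 2)
    (f : InfTorus → ℝ) (hmeas : AEMeasurable f torusMeasure)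
    (hlip : ∀ x y : InfTorus, |f x - f y| ≤ distInfty x y) :
    ∃ (A : Set ℕ) (b : InfTorus), A.Infinite ∧
      AEMeasurable f (subtorusMeasure A b) ∧
      essOsc (subtorusMeasure A b) f ≤ ENNReal.ofReal (8 * ε) := by
  have hε2 : ENNReal.ofReal ε ≠ 0 := (ENNReal.ofReal_pos.2 hε0).ne'
  obtain ⟨g, hg⟩ := exists_simpleFunc_dist_le hε0
  let f' := hmeas.mk f
  have hf' : Measurable f' := hmeas.measurable_mk
  have hint : Integrable f' torusMeasure :=
    (integrable_of_abs_sub_le_distInfty hmeas hlip).congr hmeas.ae_eq_mk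
  obtain ⟨a, D, ha, hD, hDint, hclose⟩ :=
    exists_strictMono_enorm_translate_sub_le hf' hint g.range hε2
  set A := Set.range a with hA
  obtain ⟨N, hNsub, hN, hN0⟩ := exists_measurable_superset_of_null (ae_iff.1 hmeas.ae_eq_mk)
  have hmem {x : InfTorus} (hx : x ∉ N) : f x = f' x := by
    by_contra h
    exact hx (hNsub h)
  let G : InfTorus → InfTorus := fun z i => g (z i)
  have hG : Measurable G :=
    measurable_pi_lambda _ fun i => g.measurable.comp (measurable_pi_apply i)
  have hNtrans (v : InfTorus) : ∀ᵐ b ∂torusMeasure, v + b ∉ N :=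
    ae_add_left (q := (· ∉ N)) v (measure_eq_zero_iff_ae_notMem.1 hN0)
  have hproj := measurable_subtorusProj A 0
  have hP := ae_ae_sub_of_forall_ae (q := fun z b => subtorusProj A 0 z + b ∉ N)
    (((hproj.comp measurable_fst).add measurable_snd) hN.compl) fun z => hNtrans _
  have hH := ae_ae_sub_of_forall_ae (q := fun z b => subtorusProj A 0 (G z) + b ∉ N)
    (((hproj.comp (hG.comp measurable_fst)).add measurable_snd) hN.compl) fun z => hNtrans _
  have hV := ae_ae_sub_of_forall_ae
    (q := fun z b => ‖f' (subtorusProj A 0 (G z) + b) - f' b‖ₑ ≤ D b)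
    (measurableSet_le (by fun_prop) (by fun_prop))
    fun z => hclose (G z) fun i => g.mem_range_self _
  obtain ⟨b, hb, hDb⟩ := exists_notMem_null_le_lintegral hD.aemeasurable
    (ae_iff.1 (hP.and (hH.and hV)))
  obtain ⟨hbP, hbH, hbV⟩ := not_not.1 hb
  simp only [subtorusProj_zero_sub_add] at hbP
  have hPb := measurable_subtorusProj A b
  have hff' : f =ᵐ[subtorusMeasure A b] f' := by
    have : ∀ᵐ x ∂subtorusMeasure A b, x ∉ N :=
      (ae_map_iff hPb.aemeasurable hN.compl).2 hbP
    exact this.mono fun x hx => hmem hx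
  refine ⟨A, b, Set.infinite_range_of_injective ha.injective, ⟨f', hf', hff'⟩, ?_⟩
  have hdist (y : InfTorus) :
      distInfty (subtorusProj A b y) (subtorusProj A 0 (G (y - b)) + b) ≤ ε := by
    refine ciSup_le fun i => ?_
    rw [← subtorusProj_zero_sub_add, Pi.add_apply, Pi.add_apply, dist_add_right]
    by_cases hi : i ∈ A
    · simpa only [subtorusProj, hi, if_true] using hg _
    · simpa only [subtorusProj, hi, if_false, dist_self] using hε0.le
  have hae : ∀ᵐ x ∂subtorusMeasure A b, ‖f' x - f' b‖ₑ ≤ ENNReal.ofReal (2 * ε) := by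
    refine (ae_map_iff hPb.aemeasurable (measurableSet_le (by fun_prop) (by fun_prop))).2 ?_
    filter_upwards [hbP, hbH, hbV] with y h1 h2 h3
    rw [← hmem h1, ← sub_add_sub_cancel _ (f (subtorusProj A 0 (G (y - b)) + b)), two_mul,
      ENNReal.ofReal_add hε0.le hε0.le]
    refine (enorm_add_le _ _).trans (add_le_add ?_ ?_)
    · rw [Real.enorm_eq_ofReal_abs]
      exact ENNReal.ofReal_le_ofReal ((hlip _ _).trans (hdist y))
    · rw [hmem h2]
      exact h3.trans (hDb.trans hDint)
  have : IsFiniteMeasure (subtorusMeasure A b) := by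
    unfold subtorusMeasure; infer_instance
  refine (essOsc_le_of_ae_enorm_sub_le (f' b) (r := ENNReal.ofReal (2 * ε)) ?_).trans ?_
  · filter_upwards [hff', hae] with x h1 h2
    rwa [h1]
  · rw [← ENNReal.ofReal_add (by positivity) (by positivity)]
    exact ENNReal.ofReal_le_ofReal (by linarith)
end
end

section
/- Let (aᵢ)_{i≥1} be a sequence of real numbers. Then the series ∑_{i=1}^∞ aᵢ cos(2πxᵢ) converges for σ-almost every x ∈ 𝕋^∞ if and only if ∑_{i=1}^∞ aᵢ² < ∞. -/
noncomputable section
open MeasureTheory ENNReal Filter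
open scoped Classical

/-- `cos(2πz)` for `z ∈ ℝ/ℤ`: the real part of the canonical character
`z ↦ exp(2πiz)` of `ℝ/ℤ`. -/
def cosC (z : AddCircle (1 : ℝ)) : ℝ := ((AddCircle.toCircle z : ℂ)).re

open ProbabilityTheory

namespace ProbabilityTheory

variable {Ω : Type*} {mΩ : MeasurableSpace Ω} {μ : Measure Ω}


/-- Second moment of a sum of two independent variables, one of which is centered. -/
lemma IndepFun.integral_add_sq_of_integral_eq_zero [IsProbabilityMeasure μ] {Y Z : Ω → ℝ}
    (hYZ : IndepFun Y Z μ)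
    (hY : ∀ k, Integrable (fun ω ↦ Y ω ^ k) μ) (hZ : ∀ k, Integrable (fun ω ↦ Z ω ^ k) μ)
    (hZ0 : ∫ ω, Z ω ∂μ = 0) :
    ∫ ω, (Y ω + Z ω) ^ 2 ∂μ = ∫ ω, Y ω ^ 2 ∂μ + ∫ ω, Z ω ^ 2 ∂μ := by
  have h1 : ∫ ω, Y ω * Z ω ∂μ = 0 := by
    rw [hYZ.integral_fun_mul_eq_mul_integral (by simpa using (hY 1).aestronglyMeasurable)
      (by simpa using (hZ 1).aestronglyMeasurable), hZ0, mul_zero]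
  have hi : Integrable (fun ω ↦ Y ω * Z ω) μ :=
    hYZ.integrable_mul (by simpa using hY 1) (by simpa using hZ 1)
  calc
    _ = ∫ ω, (Y ω ^ 2 + 2 * (Y ω * Z ω) + Z ω ^ 2) ∂μ := by congr 1; ext ω; ring
    _ = _ := by
      rw [integral_add ((hY 2).fun_add (hi.const_mul 2)) (hZ 2),
        integral_add (hY 2) (hi.const_mul 2), integral_const_mul, h1]
      ring

/-- Fourth moment of a sum of two independent centered variables. -/
lemma IndepFun.integral_add_pow_four_of_integral_eq_zero [IsProbabilityMeasure μ] {Y Z : Ω → ℝ}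
    (hYZ : IndepFun Y Z μ)
    (hY : ∀ k, Integrable (fun ω ↦ Y ω ^ k) μ) (hZ : ∀ k, Integrable (fun ω ↦ Z ω ^ k) μ)
    (hY0 : ∫ ω, Y ω ∂μ = 0) (hZ0 : ∫ ω, Z ω ∂μ = 0) :
    ∫ ω, (Y ω + Z ω) ^ 4 ∂μ =
      ∫ ω, Y ω ^ 4 ∂μ + 6 * ((∫ ω, Y ω ^ 2 ∂μ) * ∫ ω, Z ω ^ 2 ∂μ) + ∫ ω, Z ω ^ 4 ∂μ := by
  have hind (j k : ℕ) : IndepFun (fun ω ↦ Y ω ^ j) (fun ω ↦ Z ω ^ k) μ :=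
    hYZ.comp (φ := (· ^ j)) (ψ := (· ^ k)) (by fun_prop) (by fun_prop)
  have hmoment (j k : ℕ) : Integrable (fun ω ↦ Y ω ^ j * Z ω ^ k) μ :=
    (hind j k).integrable_mul (hY j) (hZ k)
  have hmul (j k : ℕ) : ∫ ω, Y ω ^ j * Z ω ^ k ∂μ = (∫ ω, Y ω ^ j ∂μ) * ∫ ω, Z ω ^ k ∂μ :=
    (hind j k).integral_fun_mul_eq_mul_integral (hY j).aestronglyMeasurable
      (hZ k).aestronglyMeasurable
  calc
    _ = ∫ ω, (Y ω ^ 4 + 4 * (Y ω ^ 3 * Z ω ^ 1) + 6 * (Y ω ^ 2 * Z ω ^ 2)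
          + 4 * (Y ω ^ 1 * Z ω ^ 3) + Z ω ^ 4) ∂μ := by congr 1; ext ω; ring
    _ = _ := by
      have i31 := (hmoment 3 1).const_mul 4
      have i22 := (hmoment 2 2).const_mul 6
      have i13 := (hmoment 1 3).const_mul 4
      rw [integral_add ((((hY 4).fun_add i31).fun_add i22).fun_add i13) (hZ 4),
        integral_add (((hY 4).fun_add i31).fun_add i22) i13,
        integral_add ((hY 4).fun_add i31) i22,
        integral_add (hY 4) i31]
      simp only [integral_const_mul, hmul]
      simp only [pow_one, hY0, hZ0]
      ring

/-- If `∫ S² = σ² > 0` and `∫ S⁴ ≤ 3 σ⁴` then the normalized `S² / σ²` does not concentrate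
near `0`. -/
lemma le_integral_min_sq_div [IsProbabilityMeasure μ] {S : Ω → ℝ} {v : ℝ}
    (hv : 0 < v) (hS : ∀ k, Integrable (fun ω ↦ S ω ^ k) μ)
    (h2 : ∫ ω, S ω ^ 2 ∂μ = v) (h4 : ∫ ω, S ω ^ 4 ∂μ ≤ 3 * v ^ 2) :
    3 / 4 ≤ ∫ ω, min (S ω ^ 2 / v) 3 ∂μ := by
  have hmin : Integrable (fun ω ↦ min (S ω ^ 2 / v) 3) μ :=
    ((hS 2).div_const v).inf (integrable_const 3)
  have h : ∫ ω, S ω ^ 2 / v ∂μ ≤ ∫ ω, (S ω ^ 4 / (12 * v ^ 2) + min (S ω ^ 2 / v) 3) ∂μ := by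
    refine integral_mono ((hS 2).div_const v) (((hS 4).div_const _).add hmin) fun ω ↦ ?_
    have e : S ω ^ 4 / (12 * v ^ 2) = (S ω ^ 2 / v) ^ 2 / 12 := by field_simp
    dsimp only
    rw [e]
    set u := S ω ^ 2 / v
    rcases le_total u 3 with hu | hu
    · rw [min_eq_left hu]; nlinarith [sq_nonneg u]
    · rw [min_eq_right hu]; nlinarith [sq_nonneg (u - 6)]
  rw [integral_add ((hS 4).div_const _) hmin, integral_div, integral_div, h2, div_self hv.ne'] at h
  have : (∫ ω, S ω ^ 4 ∂μ) / (12 * v ^ 2) ≤ 1 / 4 := by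
    rw [div_le_iff₀ (by positivity)]; linarith
  linarith

/-- A series of independent bounded centered variables whose fourth moments are controlled by the
squares of their variances converges almost surely iff the series of variances converges. -/
theorem iIndepFun.ae_tendsto_sum_iff_summable {X : ℕ → Ω → ℝ} {b v : ℕ → ℝ}
    (hX : iIndepFun X μ) (hm : ∀ i, Measurable (X i)) (hb : ∀ i ω, ‖X i ω‖ ≤ b i)
    (h1 : ∀ i, ∫ ω, X i ω ∂μ = 0) (h2 : ∀ i, ∫ ω, X i ω ^ 2 ∂μ = v i)
    (h4 : ∀ i, ∫ ω, X i ω ^ 4 ∂μ ≤ 3 * v i ^ 2) :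
    (∀ᵐ ω ∂μ, ∃ l : ℝ, Tendsto (fun n ↦ ∑ i ∈ Finset.range n, X i ω) atTop (nhds l)) ↔
      Summable v := by
  have := hX.isProbabilityMeasure
  set S : ℕ → Ω → ℝ := fun n ω ↦ ∑ i ∈ Finset.range n, X i ω with hS
  have hSm (n) : Measurable (S n) := by fun_prop
  have hv (i) : 0 ≤ v i := h2 i ▸ integral_nonneg fun ω ↦ sq_nonneg _
  have hpow {Y : Ω → ℝ} {C : ℝ} (hYm : Measurable Y) (hYC : ∀ ω, ‖Y ω‖ ≤ C) (k : ℕ) :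
      Integrable (fun ω ↦ Y ω ^ k) μ :=
    .of_bound (hYm.pow_const k).aestronglyMeasurable (C ^ k)
      (.of_forall fun ω ↦ by rw [norm_pow]; gcongr; exact hYC ω)
  have hXi (i) := hpow (hm i) (hb i)
  have hSi (n) := hpow (hSm n) (C := ∑ i ∈ Finset.range n, b i)
    fun ω ↦ norm_sum_le_of_le _ fun i _ ↦ hb i ω
  have hXi1 (i) : Integrable (X i) μ := by simpa using hXi i 1
  have hSi1 (n) : Integrable (S n) μ := by simpa using hSi n 1
  have hind (n) : IndepFun (S n) (X n) μ := by
    have := hX.indepFun_finsetSum_of_notMem hm (s := Finset.range n) (i := n) (by simp)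
    convert this using 1
    ext ω; simp [hS]
  have hS1 (n) : ∫ ω, S n ω ∂μ = 0 := by
    rw [integral_finsetSum _ fun i _ ↦ hXi1 i]; simp [h1]
  have hsucc (n ω) : S (n + 1) ω = S n ω + X n ω := Finset.sum_range_succ _ _
  have hS2 (n) : ∫ ω, S n ω ^ 2 ∂μ = ∑ i ∈ Finset.range n, v i := by
    induction n with
    | zero => simp [hS]
    | succ n ih =>
      simp_rw [hsucc]
      rw [(hind n).integral_add_sq_of_integral_eq_zero (hSi n) (hXi n) (h1 n), ih, h2,
        Finset.sum_range_succ]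
  have hS4 (n) : ∫ ω, S n ω ^ 4 ∂μ ≤ 3 * (∑ i ∈ Finset.range n, v i) ^ 2 := by
    induction n with
    | zero => simp [hS]
    | succ n ih =>
      simp_rw [hsucc]
      rw [(hind n).integral_add_pow_four_of_integral_eq_zero (hSi n) (hXi n) (hS1 n) (h1 n),
        hS2, h2, Finset.sum_range_succ]
      linarith [h4 n]
  constructor
  · intro h
    by_contra hns
    rw [not_summable_iff_tendsto_nat_atTop_of_nonneg hv] at hns
    have hlim : Tendsto (fun n ↦ ∫ ω, min (S n ω ^ 2 / ∑ i ∈ Finset.range n, v i) 3 ∂μ) atTop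
        (nhds (∫ _, (0 : ℝ) ∂μ)) := by
      refine tendsto_integral_of_dominated_convergence (fun _ ↦ 3)
        (fun n ↦ Measurable.aestronglyMeasurable (by fun_prop)) (integrable_const 3)
        (fun n ↦ .of_forall fun ω ↦ ?_) ?_
      · have : 0 ≤ S n ω ^ 2 / ∑ i ∈ Finset.range n, v i :=
          div_nonneg (sq_nonneg _) (Finset.sum_nonneg fun i _ ↦ hv i)
        rw [Real.norm_of_nonneg (le_min this (by norm_num))]
        exact min_le_right _ _
      · filter_upwards [h] with ω ⟨l, hl⟩
        simpa using ((hl.pow 2).div_atTop hns).min (tendsto_const_nhds (x := (3 : ℝ)))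
    rw [integral_zero] at hlim
    obtain ⟨n, hn, hn'⟩ := ((hlim.eventually_lt_const (u := 3 / 4) (by norm_num)).and
      (hns.eventually_gt_atTop 0)).exists
    exact hn.not_ge (le_integral_min_sq_div hn' (hSi n) (hS2 n) (hS4 n))
  · intro h
    have hsm (i) : StronglyMeasurable (X i) := (hm i).stronglyMeasurable
    have hmart : Martingale (fun n ↦ S (n + 1)) (Filtration.natural X hsm) μ := by
      refine martingale_of_condExp_sub_eq_zero_nat (fun n ↦ ?_) (fun n ↦ hSi1 _) fun n ↦ ?_
      · refine Finset.stronglyMeasurable_fun_sum _ fun i hi ↦ ?_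
        exact (Filtration.stronglyAdapted_natural hsm i).mono
          ((Filtration.natural X hsm).mono (Nat.lt_succ_iff.1 (Finset.mem_range.1 hi)))
      · have e : S (n + 1 + 1) - S (n + 1) = X (n + 1) := by
          ext ω; simp [hsucc]
        rw [e]
        filter_upwards [hX.condExp_natural_ae_eq_of_lt hsm n.lt_succ_self] with ω hω
        rw [hω, h1]; rfl
    have hbdd (n) : eLpNorm (S (n + 1)) 1 μ ≤ (Real.toNNReal (1 + ∑' i, v i) : ENNReal) := by
      rw [eLpNorm_one_eq_lintegral_enorm, ← ofReal_integral_norm_eq_lintegral_enorm (hSi1 _)]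
      refine ENNReal.ofReal_le_ofReal ?_
      calc ∫ ω, ‖S (n + 1) ω‖ ∂μ ≤ ∫ ω, (1 + S (n + 1) ω ^ 2) ∂μ := by
            refine integral_mono (hSi1 _).norm ((integrable_const 1).add (hSi _ 2)) fun ω ↦ ?_
            dsimp only
            rw [Real.norm_eq_abs, ← sq_abs]
            nlinarith [sq_nonneg (|S (n + 1) ω| - 1), abs_nonneg (S (n + 1) ω)]
        _ = 1 + ∑ i ∈ Finset.range (n + 1), v i := by
            rw [integral_add (integrable_const 1) (hSi _ 2), hS2]; simp
        _ ≤ _ := by gcongr; exact h.sum_le_tsum _ fun i _ ↦ hv i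
    filter_upwards [hmart.submartingale.ae_tendsto_limitProcess hbdd] with ω hω
    exact ⟨_, (tendsto_add_atTop_iff_nat (f := fun n ↦ S n ω) 1).1 hω⟩

end ProbabilityTheory

lemma torusMeasure_eq_infinitePi :
    torusMeasure =
      Measure.infinitePi fun _ : ℕ ↦ (AddCircle.haarAddCircle : Measure (AddCircle (1 : ℝ))) := by
  set ν := Measure.infinitePi fun _ : ℕ ↦ (AddCircle.haarAddCircle : Measure (AddCircle (1 : ℝ)))
  have : ν.IsAddLeftInvariant := ⟨fun g ↦ by
    have := Measure.infinitePi_map_pi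
      (fun _ : ℕ ↦ (AddCircle.haarAddCircle : Measure (AddCircle (1 : ℝ))))
      (f := fun i x ↦ g i + x) (fun i ↦ by fun_prop)
    simp only [map_add_left_eq_self] at this
    exact this⟩
  have h := Measure.addHaarMeasure_unique ν (⊤ : TopologicalSpace.PositiveCompacts InfTorus)
  rw [TopologicalSpace.PositiveCompacts.coe_top, measure_univ, one_smul] at h
  exact h.symm

lemma continuous_cosC : Continuous cosC :=
  Complex.continuous_re.comp (continuous_subtype_val.comp AddCircle.continuous_toCircle)

lemma cosC_coe (t : ℝ) : cosC (t : AddCircle (1 : ℝ)) = Real.cos (2 * Real.pi * t) := by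
  rw [cosC, AddCircle.toCircle_apply_mk, Circle.coe_exp, Complex.exp_ofReal_mul_I_re, div_one]

lemma abs_cosC_le_one (z : AddCircle (1 : ℝ)) : |cosC z| ≤ 1 := by
  induction z using QuotientAddGroup.induction_on with | H t =>
  exact (cosC_coe t).symm ▸ Real.abs_cos_le_one _

lemma cosC_add_half (z : AddCircle (1 : ℝ)) :
    cosC (z + ((1 / 2 : ℝ) : AddCircle (1 : ℝ))) = -cosC z := by
  induction z using QuotientAddGroup.induction_on with | H t =>
  rw [← AddCircle.coe_add, cosC_coe, cosC_coe]
  rw [← Real.cos_add_pi]; congr 1; ring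

lemma cosC_add_quarter_sq (z : AddCircle (1 : ℝ)) :
    cosC (z + ((1 / 4 : ℝ) : AddCircle (1 : ℝ))) ^ 2 = 1 - cosC z ^ 2 := by
  induction z using QuotientAddGroup.induction_on with | H t =>
  rw [← AddCircle.coe_add, cosC_coe, cosC_coe]
  rw [← Real.sin_sq, show 2 * Real.pi * (t + 1 / 4) = 2 * Real.pi * t + Real.pi / 2 by ring,
    Real.cos_add_pi_div_two, neg_sq]

lemma integrable_cosC_pow (k : ℕ) : Integrable (fun z ↦ cosC z ^ k) AddCircle.haarAddCircle :=
  .of_bound (continuous_cosC.pow k).aestronglyMeasurable 1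
    (.of_forall fun z ↦ by
      rw [norm_pow]; exact pow_le_one₀ (norm_nonneg _) (abs_cosC_le_one z))

lemma integral_cosC : ∫ z, cosC z ∂AddCircle.haarAddCircle = 0 := by
  have h := integral_add_right_eq_self (μ := AddCircle.haarAddCircle) cosC
    ((1 / 2 : ℝ) : AddCircle (1 : ℝ))
  simp only [cosC_add_half, integral_neg] at h
  linarith

lemma integral_cosC_sq : ∫ z, cosC z ^ 2 ∂AddCircle.haarAddCircle = 1 / 2 := by
  have h := integral_add_right_eq_self (μ := AddCircle.haarAddCircle) (fun z ↦ cosC z ^ 2)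
    ((1 / 4 : ℝ) : AddCircle (1 : ℝ))
  simp only [cosC_add_quarter_sq] at h
  rw [integral_sub (integrable_const 1) (integrable_cosC_pow 2)] at h
  simp at h
  linarith

lemma integral_cosC_pow_four_le : ∫ z, cosC z ^ 4 ∂AddCircle.haarAddCircle ≤ 3 / 4 := by
  calc
    _ ≤ ∫ z, cosC z ^ 2 ∂AddCircle.haarAddCircle := by
      refine integral_mono (integrable_cosC_pow 4) (integrable_cosC_pow 2) fun z ↦ ?_
      have : cosC z ^ 2 ≤ 1 := (sq_le_one_iff_abs_le_one _).2 (abs_cosC_le_one z)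
      dsimp only
      nlinarith [sq_nonneg (cosC z)]
    _ ≤ _ := by rw [integral_cosC_sq]; norm_num

/-- Kolmogorov's three-series theorem for the random series
`∑ᵢ aᵢ cos(2πxᵢ)`. The series converges (as a limit of partial sums) for `σ`-almost every
`x ∈ 𝕋^∞` if and only if `∑ᵢ aᵢ² < ∞`. -/
theorem random_cosine_series_converges_ae_iff (a : ℕ → ℝ) :
    (∀ᵐ x ∂torusMeasure, ∃ l : ℝ,
        Tendsto (fun N => ∑ i ∈ Finset.range N, a i * cosC (x i)) atTop (nhds l)) ↔
      Summable (fun i => (a i) ^ 2) := by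
  rw [torusMeasure_eq_infinitePi]
  have hmoment (i k : ℕ) : ∫ x, (a i * cosC (x i)) ^ k ∂Measure.infinitePi
      (fun _ : ℕ ↦ (AddCircle.haarAddCircle : Measure (AddCircle (1 : ℝ)))) =
      a i ^ k * ∫ z, cosC z ^ k ∂AddCircle.haarAddCircle := by
    simp_rw [mul_pow]
    rw [integral_const_mul, ← integral_map (φ := fun x : InfTorus ↦ x i) (f := fun z ↦ cosC z ^ k)
      (measurable_pi_apply i).aemeasurable (continuous_cosC.pow k).aestronglyMeasurable,
      Measure.infinitePi_map_eval]
  have hcm : Measurable cosC := continuous_cosC.measurable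
  rw [(iIndepFun_infinitePi (X := fun i z ↦ a i * cosC z)
    fun i ↦ hcm.const_mul (a i)).ae_tendsto_sum_iff_summable (b := fun i ↦ |a i|)
    (v := fun i ↦ a i ^ 2 * (1 / 2)) (by fun_prop)]
  · exact summable_mul_right_iff (by norm_num)
  · intro i x
    rw [norm_mul]
    exact mul_le_of_le_one_right (norm_nonneg _) (abs_cosC_le_one _)
  · intro i
    simpa [integral_cosC] using hmoment i 1
  · intro i
    rw [hmoment, integral_cosC_sq]
  · intro i
    rw [hmoment]
    nlinarith [mul_le_mul_of_nonneg_left integral_cosC_pow_four_le (by positivity : 0 ≤ a i ^ 4)]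
end
end
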